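/- arXiv:1704.00239 — 4 statements merged into one kernel-verified Lean document; each statement's English description precedes it below -/
import Mathlib

section
/- Let φ : ℝ³ → ℝ be integrable with ∫_{ℝ³} φ(x) dx = 1, with x ↦ x φ(x) integrable and ∫_{ℝ³} x φ(x) dx = 0. Let U ⊆ ℝ³ be measurable, F : U → ℝ³ integrable, and X : U → ℝ³ measurable with s ↦ ‖X(s)‖ ‖F(s)‖ integrable on U. Define f(x) = ∫_U F(s) φ(x − X(s)) ds. Then for any reference point x₀ ∈ ℝ³, the total Eulerian and Lagrangian torques coincide: ∫_{ℝ³} (x − x₀) × f(x) dx = ∫_U (X(s) − x₀) × F(s) ds, where × denotes the cross product in ℝ³. -/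
open MeasureTheory

/-- The shear `(s, x) ↦ (s, x - X s)` preserves a product measure whose second factor is
translation invariant. -/
theorem measurePreserving_prodMk_sub {S V : Type*} [MeasurableSpace S] [MeasurableSpace V]
    [AddGroup V] [MeasurableSub₂ V] [MeasurableAdd V] {ν : Measure S} {μ : Measure V}
    [SFinite ν] [SFinite μ] [μ.IsAddRightInvariant] {X : S → V} (hX : Measurable X) :
    MeasurePreserving (fun p : S × V => (p.1, p.2 - X p.1)) (ν.prod μ) (ν.prod μ) :=
  (MeasurePreserving.id ν).skew_product (g := fun s x => x - X s)
    (measurable_snd.sub (hX.comp measurable_fst))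
    (Filter.Eventually.of_forall fun s => (measurePreserving_sub_right μ (X s)).map_eq)

section SpreadMoment

variable {S V W Z : Type*} [MeasurableSpace S]
  [NormedAddCommGroup V] [NormedSpace ℝ V] [MeasurableSpace V] [BorelSpace V]
  [SecondCountableTopology V]
  [NormedAddCommGroup W] [NormedSpace ℝ W] [NormedAddCommGroup Z] [NormedSpace ℝ Z]
  {ν : Measure S} {μ : Measure V}

/-- A bilinear pairing of `X s - x₀` with `F s` is integrable as soon as `F` and
`‖X‖ * ‖F‖` are. -/
theorem integrable_bilin_sub_const (B : V →L[ℝ] W →L[ℝ] Z) {X : S → V} {F : S → W}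
    (hF : Integrable F ν) (hX : Measurable X)
    (hXF : Integrable (fun s => ‖X s‖ * ‖F s‖) ν) (x₀ : V) :
    Integrable (fun s => B (X s - x₀) (F s)) ν := by
  have hXB : Integrable (fun s => B (X s) (F s)) ν := by
    refine (hXF.const_mul ‖B‖).mono'
      (B.aestronglyMeasurable_comp₂ hX.aestronglyMeasurable hF.1) ?_
    filter_upwards with s
    simpa only [mul_assoc] using B.le_opNorm₂ (X s) (F s)
  simpa only [map_sub, sub_apply] using! hXB.sub ((B x₀).integrable_comp hF)

variable [SFinite ν] [SFinite μ] [μ.IsAddRightInvariant]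

/-- The first moment, with respect to a bilinear pairing `B`, of a density spread by a kernel
`φ` of unit integral and vanishing first moment equals the first moment of the original density. -/
theorem integral_bilin_spread [CompleteSpace V] [CompleteSpace W] [CompleteSpace Z]
    (B : V →L[ℝ] W →L[ℝ] Z) {φ : V → ℝ} (hφ : Integrable φ μ) (hφ1 : ∫ x, φ x ∂μ = 1)
    (hφm : Integrable (fun x => φ x • x) μ) (hφm0 : ∫ x, φ x • x ∂μ = 0)
    {X : S → V} {F : S → W} (hF : Integrable F ν) (hX : Measurable X)
    (hXF : Integrable (fun s => ‖X s‖ * ‖F s‖) ν) (x₀ : V) :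
    ∫ x, B (x - x₀) (∫ s, φ (x - X s) • F s ∂ν) ∂μ = ∫ s, B (X s - x₀) (F s) ∂ν := by
  have hshear := measurePreserving_prodMk_sub (ν := ν) (μ := μ) hX
  have hlag := integrable_bilin_sub_const B hF hX hXF x₀
  have hforce : Integrable (fun p : S × V => φ (p.2 - X p.1) • F p.1) (ν.prod μ) :=
    hshear.integrable_comp_of_integrable
      (hF.op_fst_snd (op := fun w c => c • w) (by fun_prop)
        ⟨1, fun w c => by simp [norm_smul, mul_comm]⟩ hφ)
  have hsplit (s : S) (x : V) : B (x - x₀) (φ (x - X s) • F s) =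
      B (φ (x - X s) • (x - X s)) (F s) + φ (x - X s) • B (X s - x₀) (F s) := by
    rw [← sub_add_sub_cancel x (X s) x₀]
    simp only [map_add, map_smul, add_apply, smul_apply, smul_add]
  have htorque : Integrable (fun p : S × V => B (p.2 - x₀) (φ (p.2 - X p.1) • F p.1))
      (ν.prod μ) := by
    simp only [hsplit]
    refine hshear.integrable_comp_of_integrable
      (g := fun p : S × V => B (φ p.2 • p.2) (F p.1) + φ p.2 • B (X p.1 - x₀) (F p.1))
      (Integrable.add ?_ ?_)
    · exact hF.op_fst_snd (op := fun w v => B v w) (by fun_prop)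
        ⟨‖B‖, fun w v => (B.le_opNorm₂ v w).trans_eq (by ring)⟩ hφm
    · exact hlag.op_fst_snd (op := fun w c => c • w) (by fun_prop)
        ⟨1, fun w c => by simp [norm_smul, mul_comm]⟩ hφ
  calc ∫ x, B (x - x₀) (∫ s, φ (x - X s) • F s ∂ν) ∂μ
      = ∫ x, ∫ s, B (x - x₀) (φ (x - X s) • F s) ∂ν ∂μ := by
        refine integral_congr_ae ?_
        filter_upwards [hforce.prod_left_ae] with x hx
        exact ((B (x - x₀)).integral_comp_comm hx).symm
    _ = ∫ s, ∫ x, B (x - x₀) (φ (x - X s) • F s) ∂μ ∂ν :=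
        (integral_integral_swap htorque).symm
    _ = ∫ s, B (X s - x₀) (F s) ∂ν := by
        refine integral_congr_ae (Filter.Eventually.of_forall fun s => ?_)
        have hmoment_int : Integrable (fun y => B (φ y • y) (F s)) μ :=
          (B.flip (F s)).integrable_comp hφm
        have hmoment : ∫ y, B (φ y • y) (F s) ∂μ = 0 := by
          simpa [hφm0] using! (B.flip (F s)).integral_comp_comm hφm
        simp only [hsplit]
        rw [integral_sub_right_eq_self
            (fun y => B (φ y • y) (F s) + φ y • B (X s - x₀) (F s)) (X s),
          integral_add hmoment_int (hφ.smul_const _),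
          integral_smul_const, hφ1, one_smul, hmoment, zero_add]

end SpreadMoment

/-- If the spreading kernel `φ : ℝ³ → ℝ` has unit integral and vanishing first
moment, then the total Eulerian torque of the spread force density
`f(x) = ∫_U F(s) φ(x − X(s)) ds` about any reference point `x₀` equals the total
Lagrangian torque `∫_U (X(s) − x₀) × F(s) ds`. -/
theorem eulerian_lagrangian_torque_equivalence
    (φ : (Fin 3 → ℝ) → ℝ) (hφ : Integrable φ) (hφ1 : ∫ x, φ x = 1)
    (hφm : Integrable (fun x : Fin 3 → ℝ => φ x • x))
    (hφm0 : ∫ x : Fin 3 → ℝ, φ x • x = 0)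
    (U : Set (Fin 3 → ℝ)) (hU : MeasurableSet U)
    (F X : (Fin 3 → ℝ) → (Fin 3 → ℝ))
    (hF : IntegrableOn F U) (hX : Measurable X)
    (hXF : IntegrableOn (fun s => ‖X s‖ * ‖F s‖) U)
    (f : (Fin 3 → ℝ) → (Fin 3 → ℝ))
    (hf : ∀ x, f x = ∫ s in U, φ (x - X s) • F s)
    (x₀ : Fin 3 → ℝ) :
    ∫ x, crossProduct (x - x₀) (f x) = ∫ s in U, crossProduct (X s - x₀) (F s) := by
  simp only [hf]
  exact integral_bilin_spread (LinearMap.toContinuousBilinearMap crossProduct)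
    hφ hφ1 hφm hφm0 hF hX hXF x₀
end

section
/- Let d ≥ 1, let B = Π_{i=1}^d [a_i, b_i] ⊂ ℝ^d be a closed rectangular box with a_i < b_i, let c : ℝ → ℝ^d be continuously differentiable, and let q : ℝ^d × ℝ → ℝ be continuously differentiable. Then the function t ↦ ∫_{B + c(t)} q(x, t) dx is differentiable, and its derivative equals the Reynolds transport expression: d/dt ∫_{B+c(t)} q(x,t) dx = ∫_{B+c(t)} ∂q/∂t (x,t) dx + Σ_{i=1}^d c_i'(t) [ ∫_{x_i = b_i + c_i(t) face of B+c(t)} q(x,t) dS − ∫_{x_i = a_i + c_i(t) face of B+c(t)} q(x,t) dS ]. -/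
open MeasureTheory

/-- The integral of `g` over the face `x_i = c` of the box `Π_i [a_i, b_i] ⊆ ℝ^{m+1}`,
parametrized by the remaining `m` coordinates. -/
noncomputable def faceInt {m : ℕ} {E : Type*} [NormedAddCommGroup E] [NormedSpace ℝ E]
    (a b : Fin (m + 1) → ℝ) (g : (Fin (m + 1) → ℝ) → E) (i : Fin (m + 1)) (c : ℝ) : E :=
  ∫ y in Set.Icc (a ∘ i.succAbove) (b ∘ i.succAbove), g (i.insertNth c y)

/-- Change of variables: an integral over a translated box is an integral over the box. -/
theorem setIntegral_Icc_add {m : ℕ} (a b v : Fin m → ℝ) (f : (Fin m → ℝ) → ℝ) :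
    ∫ x in Set.Icc (a + v) (b + v), f x = ∫ y in Set.Icc a b, f (y + v) := by
  have h := (measurePreserving_add_right volume v).setIntegral_preimage_emb
    (measurableEmbedding_addRight v) f (Set.Icc (a + v) (b + v))
  simpa using h.symm

/-- Differentiation under the integral sign over a compact set, for a jointly continuous
derivative. -/
theorem hasDerivAt_setIntegral_of_continuous_deriv {X : Type*} [TopologicalSpace X] [T2Space X]
    [MeasurableSpace X] [BorelSpace X] {μ : Measure X} [IsFiniteMeasureOnCompacts μ]
    {K : Set X} (hK : IsCompact K) {G G' : X → ℝ → ℝ}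
    (hG : ∀ s, Continuous fun x => G x s)
    (hG' : Continuous fun z : X × ℝ => G' z.1 z.2)
    (hd : ∀ x s, HasDerivAt (G x) (G' x s) s) (t : ℝ) :
    HasDerivAt (fun s => ∫ x in K, G x s ∂μ) (∫ x in K, G' x t ∂μ) t := by
  obtain ⟨C, hC⟩ := (hK.prod (isCompact_closedBall t 1)).exists_bound_of_continuousOn
    hG'.continuousOn
  have h_integrable (f : X → ℝ) (hf : Continuous f) : IntegrableOn f K μ :=
    hf.continuousOn.integrableOn_compact hK
  refine (hasDerivAt_integral_of_dominated_loc_of_deriv_le (μ := μ.restrict K)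
    (F := fun s x => G x s) (F' := fun s x => G' x s) (bound := fun _ => C)
    (Metric.closedBall_mem_nhds t one_pos)
    (.of_forall fun s => (h_integrable _ (hG s)).aestronglyMeasurable) (h_integrable _ (hG t))
    (h_integrable _ (hG'.comp (Continuous.prodMk_left t))).aestronglyMeasurable ?_ ?_
    (.of_forall fun x s _ => hd x s)).2
  · filter_upwards [ae_restrict_mem hK.measurableSet] with x hx s hs
    exact hC (x, s) ⟨hx, hs⟩
  · exact h_integrable _ continuous_const

/-- The integral of a directional derivative over a box is the flux through its faces. -/
theorem integral_fderiv_apply_eq_sum_faceInt {n : ℕ} {a b : Fin (n + 1) → ℝ} (hab : a ≤ b)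
    (v : Fin (n + 1) → ℝ) {f : (Fin (n + 1) → ℝ) → ℝ} (hf : ContDiff ℝ 1 f) :
    ∫ x in Set.Icc a b, fderiv ℝ f x v =
      ∑ i, v i * (faceInt a b f i (b i) - faceInt a b f i (a i)) := by
  have hsum (x : Fin (n + 1) → ℝ) :
      ∑ i, (v i • fderiv ℝ f x) (Pi.single i 1) = fderiv ℝ f x v := by
    conv_rhs => rw [pi_eq_sum_univ' v, map_sum]
    refine Finset.sum_congr rfl fun i _ => ?_
    rw [map_smul, smul_apply]
  have hdiv := integral_divergence_of_hasFDerivAt_off_countable' a b hab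
    (fun i x => v i * f x) (fun i x => v i • fderiv ℝ f x) ∅ Set.countable_empty
    (fun i => (hf.continuous.const_mul (v i)).continuousOn)
    (fun x _ i => ((hf.differentiable one_ne_zero).differentiableAt.hasFDerivAt).const_mul (v i))
    (by
      simp_rw [hsum]
      exact ((hf.continuous_fderiv one_ne_zero).clm_apply
        continuous_const).continuousOn.integrableOn_compact isCompact_Icc)
  simp_rw [hsum] at hdiv
  rw [hdiv]
  simp only [faceInt, integral_const_mul, mul_sub]

/-- Reynolds transport theorem for a rigidly translating rectangular box in
`ℝ^d` (`d = n+1 ≥ 1`): for a `C¹` translation `c : ℝ → ℝ^d` and a `C¹` integrand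
`q : ℝ^d × ℝ → ℝ`, the function `t ↦ ∫_{B + c(t)} q(x,t) dx` is differentiable, with
`d/dt ∫_{B+c(t)} q dx = ∫_{B+c(t)} ∂q/∂t dx + Σ_i c_i'(t) [ (upper i-face integral of q)
− (lower i-face integral of q) ]`. -/
theorem reynolds_transport_translating_box
    (n : ℕ) (a b : Fin (n + 1) → ℝ) (hab : ∀ i, a i < b i)
    (c : ℝ → Fin (n + 1) → ℝ) (hc : ContDiff ℝ 1 c)
    (q : (Fin (n + 1) → ℝ) → ℝ → ℝ)
    (hq : ContDiff ℝ 1 (fun z : (Fin (n + 1) → ℝ) × ℝ => q z.1 z.2)) :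
    ∀ t : ℝ,
      HasDerivAt
        (fun τ => ∫ x in Set.Icc (fun i => a i + c τ i) (fun i => b i + c τ i), q x τ)
        ((∫ x in Set.Icc (fun i => a i + c t i) (fun i => b i + c t i), deriv (q x) t)
          + ∑ i, deriv c t i *
              (faceInt (fun i' => a i' + c t i') (fun i' => b i' + c t i')
                  (fun x => q x t) i (b i + c t i)
                - faceInt (fun i' => a i' + c t i') (fun i' => b i' + c t i')
                    (fun x => q x t) i (a i + c t i))) t := by
  intro t
  set Q : (Fin (n + 1) → ℝ) × ℝ → ℝ := fun z => q z.1 z.2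
  have hQd (z) : HasFDerivAt Q (fderiv ℝ Q z) z :=
    (hq.differentiable one_ne_zero).differentiableAt.hasFDerivAt
  have hQ' : Continuous (fderiv ℝ Q) := hq.continuous_fderiv one_ne_zero
  have hcd (s : ℝ) : HasDerivAt c (deriv c s) s :=
    (hc.differentiable one_ne_zero).differentiableAt.hasDerivAt
  have hc' : Continuous (deriv c) := hc.continuous_deriv_one
  have hcc : Continuous c := hc.continuous
  have hmain := hasDerivAt_setIntegral_of_continuous_deriv (μ := volume)
    (isCompact_Icc (a := a) (b := b)) (G := fun y s => q (y + c s) s)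
    (G' := fun y s => fderiv ℝ Q (y + c s, s) (deriv c s, 1))
    (fun s => hq.continuous.comp (f := fun y => (y + c s, s)) (by fun_prop))
    (by fun_prop)
    (fun y s => (hQd (y + c s, s)).comp_hasDerivAt (f := fun s => (y + c s, s)) s
      (((hcd s).const_add y).prodMk (hasDerivAt_id s))) t
  have htime (x : Fin (n + 1) → ℝ) : deriv (q x) t = fderiv ℝ Q (x, t) (0, 1) :=
    ((hQd (x, t)).comp_hasDerivAt t
      ((hasDerivAt_const t x).prodMk (hasDerivAt_id t))).deriv
  have hspace (x : Fin (n + 1) → ℝ) :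
      fderiv ℝ (fun x => q x t) x (deriv c t) = fderiv ℝ Q (x, t) (deriv c t, 0) := by
    have h := HasFDerivAt.comp (f := fun x => (x, t)) x (hQd (x, t)) (hasFDerivAt_prodMk_left x t)
    change fderiv ℝ (Q ∘ fun x => (x, t)) x _ = _
    rw [h.fderiv]
    simp
  have h_integrable (w : (Fin (n + 1) → ℝ) × ℝ) :
      IntegrableOn (fun x => fderiv ℝ Q (x, t) w) (Set.Icc (a + c t) (b + c t)) :=
    Continuous.integrableOn_Icc (by fun_prop)
  have hflux := integral_fderiv_apply_eq_sum_faceInt (a := a + c t) (b := b + c t)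
    (add_le_add_left (fun i => (hab i).le) _) (deriv c t) (f := fun x => q x t)
    (hq.comp (contDiff_id.prodMk contDiff_const))
  have hvalue : ∫ y in Set.Icc a b, fderiv ℝ Q (y + c t, t) (deriv c t, 1) =
      (∫ x in Set.Icc (a + c t) (b + c t), deriv (q x) t) +
        ∫ x in Set.Icc (a + c t) (b + c t), fderiv ℝ (fun x => q x t) x (deriv c t) := by
    rw [← setIntegral_Icc_add a b (c t) fun x => fderiv ℝ Q (x, t) (deriv c t, 1)]
    simp_rw [htime, hspace]
    rw [← integral_add (h_integrable _) (h_integrable _)]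
    simp [← map_add]
  rw [hvalue, hflux] at hmain
  simp_rw [← fun s => setIntegral_Icc_add a b (c s) fun x => q x s] at hmain
  exact hmain
end

section
/- Let d ≥ 1, let B ⊂ ℝ^d be a compact rectangular box Π_{i=1}^d [a_i, b_i], let c : ℝ → ℝ^d be differentiable at t₀, and let q : ℝ^d × ℝ → ℝ be continuously differentiable. Then the function t ↦ ∫_B q(y + c(t), t) dy is differentiable at t₀ with derivative ∫_B [ ∂q/∂t (y + c(t₀), t₀) + c'(t₀) · ∇_x q(y + c(t₀), t₀) ] dy, where ∇_x q denotes the spatial gradient of q and · the Euclidean inner product. -/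
open MeasureTheory

/-- Differentiation under the integral sign over a compact set, for translates of a `C¹` function
composed with a continuous map `ι`. -/
theorem hasFDerivAt_setIntegral_comp_add {E F G : Type*} [TopologicalSpace E] [T2Space E]
    [MeasurableSpace E] [OpensMeasurableSpace E]
    [NormedAddCommGroup F] [NormedSpace ℝ F] [FiniteDimensional ℝ F]
    [NormedAddCommGroup G] [NormedSpace ℝ G]
    (μ : Measure E) [IsFiniteMeasureOnCompacts μ] {K : Set E} (hK : IsCompact K)
    {ι : E → F} (hι : Continuous ι) {q : F → G} (hq : ContDiff ℝ 1 q) (p₀ : F) :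
    IntegrableOn (fun y => fderiv ℝ q (ι y + p₀)) K μ ∧
      HasFDerivAt (fun p => ∫ y in K, q (ι y + p) ∂μ)
        (∫ y in K, fderiv ℝ q (ι y + p₀) ∂μ) p₀ := by
  have hq' : Continuous (fderiv ℝ q) := hq.continuous_fderiv one_ne_zero
  have hint (p : F) : IntegrableOn (fun y => q (ι y + p)) K μ :=
    (hq.continuous.comp (hι.add continuous_const)).continuousOn.integrableOn_compact' hK
      hK.measurableSet
  have hint' : IntegrableOn (fun y => fderiv ℝ q (ι y + p₀)) K μ :=
    (hq'.comp (hι.add continuous_const)).continuousOn.integrableOn_compact' hK hK.measurableSet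
  obtain ⟨C, hC⟩ := (hK.prod (isCompact_closedBall p₀ 1)).exists_bound_of_continuousOn
    (f := fun z : E × F => fderiv ℝ q (ι z.1 + z.2))
    (hq'.comp ((hι.comp continuous_fst).add continuous_snd)).continuousOn
  refine ⟨hint', hasFDerivAt_integral_of_dominated_of_fderiv_le
    (F' := fun p y => fderiv ℝ q (ι y + p)) (bound := fun _ => C)
    (Metric.ball_mem_nhds p₀ one_pos) (.of_forall fun p => (hint p).aestronglyMeasurable)
    (hint p₀) hint'.aestronglyMeasurable ?_ (integrableOn_const hK.measure_lt_top.ne) ?_⟩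
  · filter_upwards [ae_restrict_mem hK.measurableSet] with y hy p hp
    exact hC (y, p) ⟨hy, Metric.ball_subset_closedBall hp⟩
  · refine .of_forall fun y p _ => ?_
    exact (hq.differentiable one_ne_zero _).hasFDerivAt.comp p ((hasFDerivAt_id p).const_add (ι y))

/-- differentiation under the integral sign for a translating box: for a compact
rectangular box `B = Π_i [a_i, b_i] ⊆ ℝ^d` (`d ≥ 1`), a path `c` differentiable at `t₀`, and a
`C¹` function `q : ℝ^d × ℝ → ℝ`, the map `t ↦ ∫_B q(y + c(t), t) dy` is differentiable at `t₀`
with derivative `∫_B [ ∂q/∂t (y + c(t₀), t₀) + c'(t₀) · ∇_x q (y + c(t₀), t₀) ] dy`. -/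
theorem deriv_integral_translating_box
    (d : ℕ) (hd : 1 ≤ d) (a b : Fin d → ℝ)
    (c : ℝ → Fin d → ℝ) (t₀ : ℝ) (hc : DifferentiableAt ℝ c t₀)
    (q : (Fin d → ℝ) × ℝ → ℝ) (hq : ContDiff ℝ 1 q) :
    HasDerivAt (fun t => ∫ y in Set.Icc a b, q (y + c t, t))
      (∫ y in Set.Icc a b,
        (fderiv ℝ q (y + c t₀, t₀) (0, 1)
          + fderiv ℝ q (y + c t₀, t₀) (deriv c t₀, 0))) t₀ := by
  obtain ⟨hint, hF⟩ := hasFDerivAt_setIntegral_comp_add volume (isCompact_Icc (a := a) (b := b))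
    (ι := fun y => (y, (0 : ℝ))) (by fun_prop) hq (c t₀, t₀)
  have h := hF.comp_hasDerivAt_of_eq t₀ (hc.hasDerivAt.prodMk (hasDerivAt_id t₀)) rfl
  rw [ContinuousLinearMap.integral_apply hint] at h
  simpa [Function.comp_def, ← map_add] using h
end

section
/- Let d ≥ 1, ρ > 0, μ > 0, and let B = Π_{i=1}^d [a_i, b_i] ⊂ ℝ^d be a closed rectangular box with a_i < b_i. Let φ : ℝ^d → ℝ be integrable with ∫ φ = 1, let U ⊆ ℝ^d be measurable, F : U → ℝ^d integrable, X : U → ℝ^d measurable, and suppose the spread Eulerian force density f(x) = ∫_U F(s) φ(x − X(s)) ds vanishes for all x outside B. Fix a time t and suppose on a neighborhood of B the velocity u(·,t) is twice continuously differentiable in space and differentiable in time with ∇·u = 0, the pressure p(·,t) is continuously differentiable, f is continuous, and ρ(∂u/∂t + (u·∇)u) = −∇p + μ Δu + f holds on B. Then the total Lagrange multiplier force equals the control-volume expression: ∫_U F(s) ds = ∫_B ρ ∂u/∂t dV − ∮_{∂B} n·(−pI − ρ u⊗u + μ(∇u + ∇uᵀ)) dS, where the boundary flux denotes, componentwise,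 Σ_{i=1}^d [(upper face x_i = b_i integral of the matrix applied to e_i) − (lower face x_i = a_i integral)]. -/
open MeasureTheory

/-- The partial derivative `∂_j g (x)` of a field on `ℝ^m`. -/
noncomputable def pd {m : ℕ} {E : Type*} [NormedAddCommGroup E] [NormedSpace ℝ E]
    (g : (Fin m → ℝ) → E) (j : Fin m) (x : Fin m → ℝ) : E :=
  fderiv ℝ g x (Pi.single j 1)

/-- The tensor `σ̃ = −p I − ρ u⊗u + μ(∇u + ∇uᵀ)`, entry `(k, i)`. -/
noncomputable def sigmaTilde {m : ℕ} (ρ μ : ℝ)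
    (p : (Fin m → ℝ) → ℝ) (u : (Fin m → ℝ) → Fin m → ℝ)
    (x : Fin m → ℝ) (k i : Fin m) : ℝ :=
  -(p x) * (if k = i then 1 else 0) - ρ * (u x k * u x i) + μ * (pd u i x k + pd u k x i)

open Set

/-- The components of a partial derivative are the partial derivatives of the components. -/
theorem pd_apply {m : ℕ} {ι : Type*} [Fintype ι] {g : (Fin m → ℝ) → ι → ℝ} {x : Fin m → ℝ}
    (hg : DifferentiableAt ℝ g x) (j : Fin m) (k : ι) :
    pd (fun y => g y k) j x = pd g j x k := by
  simp [pd, (hasFDerivAt_pi'.1 hg.hasFDerivAt k).fderiv]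

theorem contDiffOn_pd {m : ℕ} {E : Type*} [NormedAddCommGroup E] [NormedSpace ℝ E]
    {g : (Fin m → ℝ) → E} {V : Set (Fin m → ℝ)} (hV : IsOpen V) (hg : ContDiffOn ℝ 2 g V)
    (j : Fin m) : ContDiffOn ℝ 1 (pd g j) V :=
  (hg.fderiv_of_isOpen hV (m := 1) (by norm_num)).clm_apply contDiffOn_const

theorem pd_comm {m : ℕ} {E : Type*} [NormedAddCommGroup E] [NormedSpace ℝ E]
    {g : (Fin m → ℝ) → E} {x : Fin m → ℝ} (hg : ContDiffAt ℝ 2 g x) (i j : Fin m) :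
    pd (pd g i) j x = pd (pd g j) i x := by
  have hd : DifferentiableAt ℝ (fderiv ℝ g) x :=
    (hg.fderiv_right (m := 1) (by norm_num)).differentiableAt (by norm_num)
  have pd_pd (i j : Fin m) : pd (pd g i) j x =
      fderiv ℝ (fderiv ℝ g) x (Pi.single j 1) (Pi.single i 1) := by
    change fderiv ℝ (fun y => fderiv ℝ g y (Pi.single i 1)) x (Pi.single j 1) = _
    rw [fderiv_clm_apply hd (differentiableAt_const _)]
    simp
  rw [pd_pd, pd_pd]
  exact (hg.isSymmSndFDerivAt (by simp)) _ _

theorem continuousOn_pd {m : ℕ} {E : Type*} [NormedAddCommGroup E] [NormedSpace ℝ E]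
    {g : (Fin m → ℝ) → E} {V : Set (Fin m → ℝ)} (hV : IsOpen V) (hg : ContDiffOn ℝ 1 g V)
    (j : Fin m) : ContinuousOn (pd g j) V :=
  (hg.continuousOn_fderiv_of_isOpen hV le_rfl).clm_apply continuousOn_const

/-- The divergence theorem on a box, for fields that are `C¹` near the box. -/
theorem integral_sum_pd_eq_sum_faceInt {m : ℕ} {E : Type*} [NormedAddCommGroup E]
    [NormedSpace ℝ E] [CompleteSpace E] {a b : Fin (m + 1) → ℝ} (hab : a ≤ b)
    {V : Set (Fin (m + 1) → ℝ)} (hV : IsOpen V) (hBV : Icc a b ⊆ V)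
    {G : Fin (m + 1) → (Fin (m + 1) → ℝ) → E} (hG : ∀ i, ContDiffOn ℝ 1 (G i) V) :
    ∫ x in Icc a b, ∑ i, pd (G i) i x
      = ∑ i, (faceInt a b (G i) i (b i) - faceInt a b (G i) i (a i)) := by
  refine integral_divergence_of_hasFDerivAt_off_countable' a b hab G
    (fun i x => fderiv ℝ (G i) x) ∅ countable_empty
    (fun i => (hG i).continuousOn.mono hBV) (fun x hx i => ?_) ?_
  · have hxV : x ∈ V := hBV ⟨fun j => (hx.1 j trivial).1.le, fun j => (hx.1 j trivial).2.le⟩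
    exact (((hG i).contDiffAt (hV.mem_nhds hxV)).differentiableAt (by norm_num)).hasFDerivAt
  · exact ((continuousOn_finsetSum _ fun i _ =>
      continuousOn_pd hV (hG i) i).mono hBV).integrableOn_compact isCompact_Icc

/-- Spreading with a kernel of unit integral preserves the total force. -/
theorem integral_spread_eq {S G E : Type*} [MeasurableSpace S] [AddCommGroup G]
    [MeasurableSpace G] [MeasurableAdd₂ G] [MeasurableNeg G] [MeasurableSub₂ G]
    [NormedAddCommGroup E] [NormedSpace ℝ E] [CompleteSpace E]
    {ν : Measure S} [SFinite ν] {vol : Measure G} [SFinite vol] [vol.IsAddRightInvariant]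
    {φ : G → ℝ} (hφ : Integrable φ vol) (hφ1 : ∫ x, φ x ∂vol = 1)
    {F : S → E} (hF : Integrable F ν) {X : S → G} (hX : Measurable X) :
    ∫ x, ∫ s, φ (x - X s) • F s ∂ν ∂vol = ∫ s, F s ∂ν := by
  have shear : MeasurePreserving (fun z : S × G => (z.1, z.2 - X z.1)) (ν.prod vol)
      (ν.prod vol) := by
    refine (MeasurePreserving.id ν).skew_product (g := fun s x => x - X s) ?_ ?_
    · exact measurable_snd.sub (hX.comp measurable_fst)
    · exact Filter.Eventually.of_forall fun s => (measurePreserving_sub_right vol (X s)).map_eq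
  have hintegrable : Integrable (fun z : S × G => φ (z.2 - X z.1) • F z.1) (ν.prod vol) := by
    have h : Integrable (fun z : S × G => φ z.2 • F z.1) (ν.prod vol) :=
      (hφ.smul_prod hF).swap
    exact shear.integrable_comp_of_integrable h
  rw [integral_integral_swap (f := fun x s => φ (x - X s) • F s) hintegrable.swap]
  refine integral_congr_ae (Filter.Eventually.of_forall fun s => ?_)
  simp only [integral_smul_const, integral_sub_right_eq_self φ (X s), hφ1, one_smul]

theorem contDiffOn_sigmaTilde {m : ℕ} (ρ μ : ℝ) {p : (Fin m → ℝ) → ℝ}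
    {u : (Fin m → ℝ) → Fin m → ℝ} {V : Set (Fin m → ℝ)} (hV : IsOpen V)
    (hp : ContDiffOn ℝ 1 p V) (hu : ContDiffOn ℝ 2 u V) (k i : Fin m) :
    ContDiffOn ℝ 1 (fun x => sigmaTilde ρ μ p u x k i) V := by
  have hu1 (l : Fin m) : ContDiffOn ℝ 1 (fun x => u x l) V :=
    contDiffOn_pi.1 (hu.of_le (by norm_num)) l
  have hpd (j l : Fin m) : ContDiffOn ℝ 1 (fun x => pd u j x l) V :=
    contDiffOn_pi.1 (contDiffOn_pd hV hu j) l
  exact ((hp.neg.mul contDiffOn_const).sub (contDiffOn_const.mul ((hu1 k).mul (hu1 i)))).add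
    (contDiffOn_const.mul ((hpd i k).add (hpd k i)))

theorem pd_sigmaTilde {m : ℕ} (ρ μ : ℝ) {p : (Fin m → ℝ) → ℝ}
    {u : (Fin m → ℝ) → Fin m → ℝ} {V : Set (Fin m → ℝ)} (hV : IsOpen V)
    (hp : ContDiffOn ℝ 1 p V) (hu : ContDiffOn ℝ 2 u V) {x : Fin m → ℝ} (hx : x ∈ V)
    (k i j : Fin m) :
    pd (fun x => sigmaTilde ρ μ p u x k i) j x
      = -(pd p j x) * (if k = i then 1 else 0)
        - ρ * (u x k * pd u j x i + u x i * pd u j x k)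
        + μ * (pd (pd u i) j x k + pd (pd u k) j x i) := by
  have hxV := hV.mem_nhds hx
  have hpx : DifferentiableAt ℝ p x := (hp.contDiffAt hxV).differentiableAt (by norm_num)
  have hux : DifferentiableAt ℝ u x := (hu.contDiffAt hxV).differentiableAt (by norm_num)
  have hpdx (i : Fin m) : DifferentiableAt ℝ (pd u i) x :=
    ((contDiffOn_pd hV hu i).contDiffAt hxV).differentiableAt (by norm_num)
  have hu' (l : Fin m) := (differentiableAt_pi.1 hux l).hasFDerivAt
  have hpd' (i l : Fin m) := (differentiableAt_pi.1 (hpdx i) l).hasFDerivAt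
  have h := ((hpx.hasFDerivAt.neg.mul_const (if k = i then (1 : ℝ) else 0)).sub
    (((hu' k).mul (hu' i)).const_mul ρ)).add (((hpd' i k).add (hpd' k i)).const_mul μ)
  have e : pd (fun x => sigmaTilde ρ μ p u x k i) j x = _ :=
    congrArg (fun L => L (Pi.single j 1)) h.fderiv
  rw [e, ← pd_apply hux, ← pd_apply hux, ← pd_apply (hpdx _), ← pd_apply (hpdx _)]
  simp only [pd, add_apply, sub_apply,
    smul_apply, neg_apply, smul_eq_mul]
  ring

/-- For a solenoidal velocity field, the divergence of `σ̃` is `−∇p − ρ (u·∇)u + μ Δu`. -/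
theorem sum_pd_sigmaTilde {m : ℕ} (ρ μ : ℝ) {p : (Fin m → ℝ) → ℝ}
    {u : (Fin m → ℝ) → Fin m → ℝ} {V : Set (Fin m → ℝ)} (hV : IsOpen V)
    (hp : ContDiffOn ℝ 1 p V) (hu : ContDiffOn ℝ 2 u V)
    (hdiv : ∀ x ∈ V, ∑ j, pd u j x j = 0) {x : Fin m → ℝ} (hx : x ∈ V) (k : Fin m) :
    ∑ i, pd (fun x => sigmaTilde ρ μ p u x k i) i x
      = -(pd p k x) - ρ * ∑ j, u x j * pd u j x k + μ * ∑ j, pd (pd u j) j x k := by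
  have hxV := hV.mem_nhds hx
  have hpdx (i : Fin m) : DifferentiableAt ℝ (pd u i) x :=
    ((contDiffOn_pd hV hu i).contDiffAt hxV).differentiableAt (by norm_num)
  have hgrad : ∑ i, pd (pd u k) i x i = 0 := by
    have h0 : pd (fun y => ∑ i, pd u i y i) k x = 0 := by
      have : (fun y => ∑ i, pd u i y i) =ᶠ[nhds x] fun _ => 0 :=
        Filter.eventually_of_mem hxV hdiv
      rw [pd, this.fderiv_eq]
      simp
    rw [← h0]
    have hs : pd (fun y => ∑ i, pd u i y i) k x = ∑ i, pd (fun y => pd u i y i) k x := by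
      rw [pd, fderiv_fun_sum fun i _ => differentiableAt_pi.1 (hpdx i) i, sum_apply]
      rfl
    rw [hs]
    exact Finset.sum_congr rfl fun i _ => by
      rw [pd_apply (hpdx i), pd_comm (hu.contDiffAt hxV)]
  simp only [pd_sigmaTilde ρ μ hV hp hu hx, Finset.sum_add_distrib, Finset.sum_sub_distrib,
    ← Finset.mul_sum, hgrad, hdiv x hx]
  simp

/-- equivalence of Lagrange multiplier and control-volume force evaluations:
if the spread Eulerian force density `f(x) = ∫_U F(s) φ(x − X(s)) ds` (kernel `φ` of unit
integral) vanishes outside the box `B = Π_i [a_i, b_i] ⊆ ℝ^d` (`d = n+1 ≥ 1`), and the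
incompressible Navier–Stokes equations hold on `B` with the stated regularity on a
neighborhood of `B`, then
`∫_U F ds = ∫_B ρ ∂u/∂t dV − ∮_{∂B} n·(−pI − ρ u⊗u + μ(∇u + ∇uᵀ)) dS`. -/
theorem lagrange_multiplier_eq_control_volume_force
    (n : ℕ) (ρ μ : ℝ) (hρ : 0 < ρ) (hμ : 0 < μ)
    (a b : Fin (n + 1) → ℝ) (hab : ∀ i, a i < b i)
    (φ : (Fin (n + 1) → ℝ) → ℝ) (hφ : Integrable φ) (hφ1 : ∫ x, φ x = 1)
    (U : Set (Fin (n + 1) → ℝ)) (hU : MeasurableSet U)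
    (F X : (Fin (n + 1) → ℝ) → Fin (n + 1) → ℝ)
    (hF : IntegrableOn F U) (hX : Measurable X)
    (f : (Fin (n + 1) → ℝ) → Fin (n + 1) → ℝ)
    (hfspread : ∀ x, f x = ∫ s in U, φ (x - X s) • F s)
    (hfsupp : ∀ x ∉ Set.Icc a b, f x = 0)
    (t : ℝ)
    (V : Set (Fin (n + 1) → ℝ)) (hV : IsOpen V) (hBV : Set.Icc a b ⊆ V)
    (u : ℝ → (Fin (n + 1) → ℝ) → Fin (n + 1) → ℝ)
    (ut : (Fin (n + 1) → ℝ) → Fin (n + 1) → ℝ)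
    (p : (Fin (n + 1) → ℝ) → ℝ)
    (hu2 : ContDiffOn ℝ 2 (u t) V)
    (hut : ∀ x ∈ V, HasDerivAt (fun τ => u τ x) (ut x) t)
    (hdiv : ∀ x ∈ V, ∑ j, pd (u t) j x j = 0)
    (hp : ContDiffOn ℝ 1 p V)
    (hf : ContinuousOn f V)
    (hNS : ∀ x ∈ Set.Icc a b, ∀ i,
      ρ * (ut x i + ∑ j, u t x j * pd (u t) j x i)
        = -(pd p i x) + μ * (∑ j, pd (pd (u t) j) j x i) + f x i) :
    ∫ s in U, F s
      = (∫ x in Set.Icc a b, ρ • ut x)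
        - (fun k => ∑ i,
            (faceInt a b (fun x => sigmaTilde ρ μ p (u t) x k i) i (b i)
              - faceInt a b (fun x => sigmaTilde ρ μ p (u t) x k i) i (a i))) := by
  have hG (k : Fin (n + 1)) (i : Fin (n + 1)) :=
    contDiffOn_sigmaTilde ρ μ hV hp hu2 k i
  have htotal : ∫ s in U, F s = ∫ x in Icc a b, f x := by
    rw [setIntegral_eq_integral_of_forall_compl_eq_zero hfsupp, ← integral_spread_eq hφ hφ1 hF hX]
    exact integral_congr_ae (Filter.Eventually.of_forall fun x => (hfspread x).symm)
  have hmomentum : ∀ x ∈ Icc a b, ρ • ut x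
      = f x + fun k => ∑ i, pd (fun x => sigmaTilde ρ μ p (u t) x k i) i x := by
    intro x hx
    ext k
    simp only [Pi.smul_apply, Pi.add_apply, smul_eq_mul,
      sum_pd_sigmaTilde ρ μ hV hp hu2 hdiv (hBV hx)]
    linarith [hNS x hx k]
  have hf_int : IntegrableOn f (Icc a b) := (hf.mono hBV).integrableOn_compact isCompact_Icc
  have hdiv_int : IntegrableOn
      (fun x k => ∑ i, pd (fun x => sigmaTilde ρ μ p (u t) x k i) i x) (Icc a b) :=
    ((continuousOn_pi.2 fun k => continuousOn_finsetSum _ fun i _ =>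
      continuousOn_pd hV (hG k i) i).mono hBV).integrableOn_compact isCompact_Icc
  rw [htotal, setIntegral_congr_fun measurableSet_Icc hmomentum, integral_add hf_int hdiv_int,
    eq_sub_iff_add_eq, add_right_inj]
  ext k
  rw [eval_integral fun k => Integrable.eval hdiv_int k,
    integral_sum_pd_eq_sum_faceInt (fun i => (hab i).le) hV hBV (hG k)]
end
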